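/- The number of cyclic orderings β (up to rotation and reflection) of {1,...,n} such that β shares at least one common planar binary tree with the standard ordering (1,2,...,n) equals the super Catalan number S_{n-1}, for n ≥ 4. -/

import Mathlib

/-- `A` is a contiguous arc of the cyclic ordering given by the list `l`. -/
def IsArc (l : List ℕ) (A : Finset ℕ) : Prop :=
  ∃ k m : ℕ, A = ((l.rotate k).take m).toFinset

/-- `T` is the split system of an unrooted binary tree with leaf set `L`:
a collection of `2(|L|-3)` subsets of `L` (the two sides of each internal edge),
closed under complementation, with each member of size between `2` and `|L|-2`,
and pairwise compatible. -/
def IsTreeSplits (L : Finset ℕ) (T : Finset (Finset ℕ)) : Prop :=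
  (∀ A ∈ T, A ⊆ L ∧ 2 ≤ A.card ∧ A.card + 2 ≤ L.card) ∧
  (∀ A ∈ T, L \ A ∈ T) ∧
  (∀ A ∈ T, ∀ B ∈ T, A ⊆ B ∨ B ⊆ A ∨ A ∩ B = ∅ ∨ L ⊆ A ∪ B) ∧
  T.card = 2 * (L.card - 3)

/-- The tree with split system `T` is planar with respect to the cyclic ordering `l`:
every split is a contiguous arc of `l`. -/
def Planar (l : List ℕ) (T : Finset (Finset ℕ)) : Prop :=
  ∀ A ∈ T, IsArc l A

/-- `l` is a cyclic ordering of the finite set `L`. -/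
def IsOrdering (L : Finset ℕ) (l : List ℕ) : Prop :=
  l.Nodup ∧ l.toFinset = L

/-- `i` and `j` are cyclically adjacent in the ordering `l`. -/
def AdjPair (l : List ℕ) (i j : ℕ) : Prop :=
  ∃ k : ℕ, (l.rotate k).take 2 = [i, j] ∨ (l.rotate k).take 2 = [j, i]

/-- A diagonal of the convex `m`-gon with vertices `0, 1, ..., m-1`. -/
def IsDiagonal (m : ℕ) (p : ℕ × ℕ) : Prop :=
  p.1 + 2 ≤ p.2 ∧ p.2 ≤ m - 1 ∧ ¬(p.1 = 0 ∧ p.2 = m - 1)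

/-- Two diagonals cross. -/
def Crosses (p q : ℕ × ℕ) : Prop :=
  (p.1 < q.1 ∧ q.1 < p.2 ∧ p.2 < q.2) ∨ (q.1 < p.1 ∧ p.1 < q.2 ∧ q.2 < p.2)

/-- The super Catalan (little Schröder) number `S_r`: the number of dissections of a
convex `(r+1)`-gon by pairwise noncrossing diagonals. -/
noncomputable def superCatalan (r : ℕ) : ℕ :=
  Nat.card {D : Finset (ℕ × ℕ) //
    (∀ p ∈ D, IsDiagonal (r + 1) p) ∧ ∀ p ∈ D, ∀ q ∈ D, ¬ Crosses p q}

/-- `D` is a family of intervals `[p.1, p.2)` of length at least two, pairwise noncrossing. -/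
structure IsLaminar (D : Finset (ℕ × ℕ)) : Prop where
  two_le : ∀ p ∈ D, p.1 + 2 ≤ p.2
  not_crosses : ∀ p ∈ D, ∀ q ∈ D, ¬ Crosses p q

theorem IsLaminar.mono {D E : Finset (ℕ × ℕ)} (hD : IsLaminar D) (h : E ⊆ D) : IsLaminar E :=
  ⟨fun p hp => hD.two_le p (h hp), fun p hp q hq => hD.not_crosses p (h hp) q (h hq)⟩

/-- An interval not crossed by a laminar family can be cut in two pieces so that every member of
the family contains the interval or lies on one side of the cut. -/
theorem IsLaminar.exists_split {D : Finset (ℕ × ℕ)} (hD : IsLaminar D) {a b : ℕ} (hab : a + 2 ≤ b)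
    (h : ∀ p ∈ D, ¬ Crosses p (a, b)) :
    ∃ c, a < c ∧ c < b ∧ ∀ p ∈ D, (p.1 ≤ a ∧ b ≤ p.2) ∨ p.2 ≤ c ∨ c ≤ p.1 := by
  classical
  let P : ℕ → Prop := fun c => c < b ∧ ((a, c) ∈ D ∨ c = a + 1)
  have hP : P (a + 1) := ⟨by omega, Or.inr rfl⟩
  have hc : P (Nat.findGreatest P b) := Nat.findGreatest_spec (by omega) hP
  have hle : a + 1 ≤ Nat.findGreatest P b := Nat.le_findGreatest (by omega) hP
  refine ⟨Nat.findGreatest P b, by omega, hc.1, fun p hp => ?_⟩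
  have h1 := h p hp
  have h2 := hD.two_le p hp
  have h3 : p.1 = a → p.2 < b → p.2 ≤ Nat.findGreatest P b := fun h4 h5 =>
    Nat.le_findGreatest h5.le ⟨h5, Or.inl (by rw [← h4]; exact hp)⟩
  have h4 : (a, Nat.findGreatest P b) ∈ D → ¬ Crosses p (a, Nat.findGreatest P b) :=
    fun h5 => hD.not_crosses p hp _ h5
  obtain ⟨hc1, hc2⟩ := hc
  generalize Nat.findGreatest P b = c at *
  simp only [Crosses] at h1 h4
  rcases hc2 with h5 | h5
  · have := h4 h5
    omega
  · omega

/-- The number of intervals of `D` containing both `x` and `y`. -/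
def cover (D : Finset (ℕ × ℕ)) (x y : ℕ) : ℕ :=
  (D.filter fun p => (p.1 ≤ x ∧ x < p.2) ∧ p.1 ≤ y ∧ y < p.2).card

theorem cover_comm (D : Finset (ℕ × ℕ)) (x y : ℕ) : cover D x y = cover D y x := by
  unfold cover
  congr 1
  ext p
  simp only [Finset.mem_filter]
  tauto

/-- The order in which `x` and `y` appear after twisting along all intervals of `D`, reversed
when `s` is odd. -/
def TwistRel (D : Finset (ℕ × ℕ)) (s x y : ℕ) : Prop :=
  x < y ∧ Even (cover D x y + s) ∨ y < x ∧ ¬ Even (cover D x y + s)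

theorem TwistRel.asymm {D : Finset (ℕ × ℕ)} {s x y : ℕ} (h : TwistRel D s x y) :
    ¬ TwistRel D s y x := by
  unfold TwistRel at *
  rw [cover_comm D y x]
  rcases h with h | h
  · rintro (h' | h')
    · omega
    · exact h'.2 h.2
  · rintro (h' | h')
    · exact h.2 h'.2
    · omega

theorem TwistRel.congr {D E : Finset (ℕ × ℕ)} {s t x y : ℕ}
    (h : Even (cover D x y + s) ↔ Even (cover E x y + t)) :
    TwistRel D s x y ↔ TwistRel E t x y := by
  unfold TwistRel
  rw [h]

theorem even_cover_iff_of_pairwise {D E : Finset (ℕ × ℕ)} {s t : ℕ} {l : List ℕ}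
    (hD : l.Pairwise (TwistRel D s)) (hE : l.Pairwise (TwistRel E t)) {x y : ℕ} (hx : x ∈ l)
    (hy : y ∈ l) (hxy : x ≠ y) : Even (cover D x y + s) ↔ Even (cover E x y + t) := by
  have : Std.Symm fun x y => Even (cover D x y + s) ↔ Even (cover E x y + t) :=
    ⟨fun x y h => by rwa [cover_comm D y x, cover_comm E y x]⟩
  refine List.Pairwise.forall (R := fun x y => Even (cover D x y + s) ↔ Even (cover E x y + t))
    ((hD.and hE).imp ?_) hx hy hxy
  rintro x y ⟨h1, h2⟩
  rcases h1 with h1 | h1 <;> rcases h2 with h2 | h2 <;> first | omega | tauto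

theorem TwistRel.swap {D : Finset (ℕ × ℕ)} {s x y : ℕ} (h : TwistRel D s x y) :
    TwistRel D (s + 1) y x := by
  unfold TwistRel at *
  rw [cover_comm D y x, ← add_assoc, Nat.even_add_one]
  tauto

/-- A family of intervals is determined by the parities of the numbers of its members containing
given pairs of points. -/
theorem eq_of_even_cover_iff {D E : Finset (ℕ × ℕ)} {N : ℕ}
    (hD : ∀ p ∈ D, p.1 + 2 ≤ p.2 ∧ p.2 ≤ N) (hE : ∀ p ∈ E, p.1 + 2 ≤ p.2 ∧ p.2 ≤ N)
    (h : ∀ x < N, ∀ y < N, x ≠ y → (Even (cover D x y) ↔ Even (cover E x y))) :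
    D = E := by
  have key : ∀ k, ∀ a b, a + N = b + k → ((a, b) ∈ D ↔ (a, b) ∈ E) := by
    intro k
    induction k using Nat.strong_induction_on with
    | _ k ih =>
      intro a b hk
      by_cases hb : a + 2 ≤ b ∧ b ≤ N
      swap
      · exact ⟨fun h' => absurd (hD _ h') hb, fun h' => absurd (hE _ h') hb⟩
      have h1 := h a (by omega) (b - 1) (by omega) (by omega)
      have h2 : ∀ G : Finset (ℕ × ℕ), (∀ p ∈ G, p.1 + 2 ≤ p.2 ∧ p.2 ≤ N) →
          G.filter (fun p => (p.1 ≤ a ∧ a < p.2) ∧ p.1 ≤ b - 1 ∧ b - 1 < p.2) =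
          (G.filter fun p => p = (a, b)) ∪ G.filter fun p => p ≠ (a, b) ∧ p.1 ≤ a ∧ b ≤ p.2 := by
        intro G hG
        ext ⟨u, v⟩
        simp only [Finset.mem_filter, Finset.mem_union, ne_eq, Prod.mk.injEq]
        constructor
        · rintro ⟨h3, h4⟩
          by_cases h5 : u = a ∧ v = b
          · exact Or.inl ⟨h3, h5⟩
          · exact Or.inr ⟨h3, h5, by omega, by omega⟩
        · rintro (⟨h3, h4⟩ | ⟨h3, h4⟩) <;> exact ⟨h3, by omega⟩
      have h3 : D.filter (fun p => p ≠ (a, b) ∧ p.1 ≤ a ∧ b ≤ p.2) =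
          E.filter fun p => p ≠ (a, b) ∧ p.1 ≤ a ∧ b ≤ p.2 := by
        ext ⟨u, v⟩
        simp only [Finset.mem_filter]
        refine and_congr_left fun ⟨h4, h5, h6⟩ => ?_
        simp only [ne_eq, Prod.mk.injEq] at h4 h5 h6
        by_cases hv : v ≤ N
        · exact ih (u + N - v) (by omega) u v (by omega)
        · exact ⟨fun h' => absurd (hD _ h').2 hv, fun h' => absurd (hE _ h').2 hv⟩
      simp only [cover, h2 D hD, h2 E hE, h3,
        Finset.filter_eq'] at h1
      by_cases h5 : (a, b) ∈ D <;> by_cases h6 : (a, b) ∈ E <;>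
        simp [h5, h6, parity_simps] at h1 ⊢
      all_goals
        rw [← Nat.not_even_iff_odd] at h1
        tauto
  ext ⟨a, b⟩
  by_cases hb : b ≤ N
  · exact key (a + N - b) a b (by omega)
  · exact ⟨fun h' => absurd (hD _ h').2 hb, fun h' => absurd (hE _ h').2 hb⟩

/-- `l` lists the interval `[a, b)` in an order obtained by repeatedly concatenating such lists
for two consecutive intervals, in either order. -/
inductive Separable : ℕ → ℕ → List ℕ → Prop
  | single (a : ℕ) : Separable a (a + 1) [a]
  | sum {a c b : ℕ} {l₁ l₂ : List ℕ} :
      Separable a c l₁ → Separable c b l₂ → Separable a b (l₁ ++ l₂)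
  | skew {a c b : ℕ} {l₁ l₂ : List ℕ} :
      Separable a c l₁ → Separable c b l₂ → Separable a b (l₂ ++ l₁)

namespace Separable

theorem lt {a b : ℕ} {l : List ℕ} (h : Separable a b l) : a < b := by
  induction h <;> omega

theorem mem_iff {a b : ℕ} {l : List ℕ} (h : Separable a b l) {x : ℕ} :
    x ∈ l ↔ a ≤ x ∧ x < b := by
  induction h with
  | single a => simp; omega
  | sum h1 h2 ih1 ih2 =>
    have := h1.lt
    have := h2.lt
    rw [List.mem_append, ih1, ih2]; omega
  | skew h1 h2 ih1 ih2 =>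
    have := h1.lt
    have := h2.lt
    rw [List.mem_append, ih1, ih2]; omega

theorem nodup {a b : ℕ} {l : List ℕ} (h : Separable a b l) : l.Nodup := by
  induction h with
  | single a => simp
  | sum h1 h2 ih1 ih2 =>
    refine ih1.append ih2 fun x hx1 hx2 => ?_
    rw [h1.mem_iff] at hx1
    rw [h2.mem_iff] at hx2
    omega
  | skew h1 h2 ih1 ih2 =>
    refine ih2.append ih1 fun x hx1 hx2 => ?_
    rw [h2.mem_iff] at hx1
    rw [h1.mem_iff] at hx2
    omega

end Separable

/-- Twisting an interval along a laminar family gives a separable list. -/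
theorem IsLaminar.exists_separable {D : Finset (ℕ × ℕ)} (hD : IsLaminar D) {a b : ℕ} (hab : a < b)
    (h : ∀ p ∈ D, ¬ Crosses p (a, b)) :
    ∃ l, Separable a b l ∧ l.Pairwise (TwistRel D 0) := by
  obtain ⟨k, hk⟩ : ∃ k, b = a + k := ⟨b - a, by omega⟩
  induction k using Nat.strong_induction_on generalizing a b with
  | _ k ih =>
    by_cases hab2 : b = a + 1
    · subst hab2
      exact ⟨[a], .single a, by simp⟩
    obtain ⟨c, hac, hcb, hc⟩ := hD.exists_split (by omega : a + 2 ≤ b) h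
    obtain ⟨l₁, hl₁, hp₁⟩ := ih (c - a) (by omega) hac (fun p hp => by
      have h1 := hc p hp
      have h2 := h p hp
      simp only [Crosses] at h2 ⊢
      omega) (by omega)
    obtain ⟨l₂, hl₂, hp₂⟩ := ih (b - c) (by omega) hcb (fun p hp => by
      have h1 := hc p hp
      have h2 := h p hp
      simp only [Crosses] at h2 ⊢
      omega) (by omega)
    have hcov : ∀ x ∈ l₁, ∀ y ∈ l₂, x < y ∧ cover D x y = cover D a (b - 1) := by
      intro x hx y hy
      rw [hl₁.mem_iff] at hx
      rw [hl₂.mem_iff] at hy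
      refine ⟨by omega, ?_⟩
      unfold cover
      congr 1
      ext p
      simp only [Finset.mem_filter]
      refine and_congr_right fun hp => ?_
      have := hc p hp
      omega
    by_cases hev : Even (cover D a (b - 1))
    · refine ⟨l₁ ++ l₂, hl₁.sum hl₂, List.pairwise_append.2 ⟨hp₁, hp₂, fun x hx y hy => ?_⟩⟩
      obtain ⟨h1, h2⟩ := hcov x hx y hy
      exact Or.inl ⟨h1, by rwa [h2]⟩
    · refine ⟨l₂ ++ l₁, hl₁.skew hl₂, List.pairwise_append.2 ⟨hp₂, hp₁, fun y hy x hx => ?_⟩⟩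
      obtain ⟨h1, h2⟩ := hcov x hx y hy
      exact Or.inr ⟨h1, by rwa [cover_comm, h2]⟩

theorem cover_union {D E : Finset (ℕ × ℕ)} (h : Disjoint D E) (x y : ℕ) :
    cover (D ∪ E) x y = cover D x y + cover E x y := by
  unfold cover
  rw [Finset.filter_union, Finset.card_union_of_disjoint (Finset.disjoint_filter_filter h)]

theorem cover_insert {D : Finset (ℕ × ℕ)} {a b : ℕ} (h : (a, b) ∉ D) {x y : ℕ}
    (hx : a ≤ x ∧ x < b) (hy : a ≤ y ∧ y < b) :
    cover (insert (a, b) D) x y = cover D x y + 1 := by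
  unfold cover
  rw [Finset.filter_insert, if_pos ⟨hx, hy⟩, Finset.card_insert_of_notMem (by simp [h])]

theorem cover_eq_zero {D : Finset (ℕ × ℕ)} {x y : ℕ}
    (h : ∀ p ∈ D, ¬ ((p.1 ≤ x ∧ x < p.2) ∧ p.1 ≤ y ∧ y < p.2)) : cover D x y = 0 := by
  unfold cover
  rw [Finset.card_eq_zero, Finset.filter_eq_empty_iff]
  exact @h

/-- Two laminar families on consecutive intervals `[a, c)` and `[c, b)`, twisting given lists. -/
theorem pairwise_union {D₁ D₂ : Finset (ℕ × ℕ)} {a c b s : ℕ} {l₁ l₂ : List ℕ}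
    (h₁ : ∀ p ∈ D₁, a ≤ p.1 ∧ p.2 ≤ c) (h₂ : ∀ p ∈ D₂, c ≤ p.1 ∧ p.2 ≤ b)
    (hd : Disjoint D₁ D₂) (hs₁ : Separable a c l₁) (hs₂ : Separable c b l₂)
    (hp₁ : l₁.Pairwise (TwistRel D₁ s)) (hp₂ : l₂.Pairwise (TwistRel D₂ s)) :
    l₁.Pairwise (TwistRel (D₁ ∪ D₂) s) ∧ l₂.Pairwise (TwistRel (D₁ ∪ D₂) s) ∧
      ∀ x ∈ l₁, ∀ y ∈ l₂, x < y ∧ cover (D₁ ∪ D₂) x y = 0 := by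
  refine ⟨hp₁.imp_of_mem fun {x y} hx hy h => ?_, hp₂.imp_of_mem fun {x y} hx hy h => ?_,
    fun x hx y hy => ?_⟩
  · rw [hs₁.mem_iff] at hx hy
    rwa [TwistRel.congr (t := s) (E := D₁)]
    rw [cover_union hd, cover_eq_zero (D := D₂), add_zero]
    intro p hp
    have := h₂ p hp
    omega
  · rw [hs₂.mem_iff] at hx hy
    rwa [TwistRel.congr (t := s) (E := D₂)]
    rw [cover_union hd, cover_eq_zero (D := D₁), zero_add]
    intro p hp
    have := h₁ p hp
    omega
  · rw [hs₁.mem_iff] at hx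
    rw [hs₂.mem_iff] at hy
    refine ⟨by omega, cover_eq_zero fun p hp => ?_⟩
    rcases Finset.mem_union.1 hp with hp | hp
    · have := h₁ p hp
      omega
    · have := h₂ p hp
      omega

theorem IsLaminar.union {D₁ D₂ : Finset (ℕ × ℕ)} {a c b : ℕ} (hD₁ : IsLaminar D₁)
    (hD₂ : IsLaminar D₂) (h₁ : ∀ p ∈ D₁, a ≤ p.1 ∧ p.2 ≤ c) (h₂ : ∀ p ∈ D₂, c ≤ p.1 ∧ p.2 ≤ b) :
    IsLaminar (D₁ ∪ D₂) ∧ Disjoint D₁ D₂ := by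
  refine ⟨⟨fun p hp => ?_, fun p hp q hq => ?_⟩, Finset.disjoint_left.2 fun p hp hp' => ?_⟩
  · rcases Finset.mem_union.1 hp with hp | hp
    exacts [hD₁.two_le p hp, hD₂.two_le p hp]
  · rcases Finset.mem_union.1 hp with hp | hp <;> rcases Finset.mem_union.1 hq with hq | hq
    · exact hD₁.not_crosses p hp q hq
    · have := h₁ p hp
      have := h₂ q hq
      unfold Crosses
      omega
    · have := h₂ p hp
      have := h₁ q hq
      unfold Crosses
      omega
    · exact hD₂.not_crosses p hp q hq
  · have := h₁ p hp
    have := h₂ p hp'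
    have := hD₁.two_le p hp
    omega

theorem IsLaminar.insert {D : Finset (ℕ × ℕ)} {a b : ℕ} (hD : IsLaminar D) (hab : a + 2 ≤ b)
    (h : ∀ p ∈ D, a ≤ p.1 ∧ p.2 ≤ b) : IsLaminar (insert (a, b) D) := by
  refine ⟨fun p hp => ?_, fun p hp q hq => ?_⟩
  · rcases Finset.mem_insert.1 hp with rfl | hp
    exacts [hab, hD.two_le p hp]
  · rcases Finset.mem_insert.1 hp with rfl | hp <;> rcases Finset.mem_insert.1 hq with rfl | hq
    · unfold Crosses
      omega
    · have := h q hq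
      unfold Crosses
      omega
    · have := h p hp
      unfold Crosses
      omega
    · exact hD.not_crosses p hp q hq

theorem exists_isLaminar_join {a c b : ℕ} {l₁ l₂ : List ℕ} (hs₁ : Separable a c l₁)
    (hs₂ : Separable c b l₂)
    (ih₁ : ∀ s, ∃ D, IsLaminar D ∧ (∀ p ∈ D, a ≤ p.1 ∧ p.2 ≤ c) ∧ l₁.Pairwise (TwistRel D s))
    (ih₂ : ∀ s, ∃ D, IsLaminar D ∧ (∀ p ∈ D, c ≤ p.1 ∧ p.2 ≤ b) ∧ l₂.Pairwise (TwistRel D s))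
    (s t : ℕ) :
    ∃ D, IsLaminar D ∧ (∀ p ∈ D, a ≤ p.1 ∧ p.2 ≤ b) ∧ l₁.Pairwise (TwistRel D s) ∧
      l₂.Pairwise (TwistRel D s) ∧
      ∀ x ∈ l₁, ∀ y ∈ l₂, x < y ∧ (Even (cover D x y + s) ↔ Even t) := by
  have hac := hs₁.lt
  have hcb := hs₂.lt
  have key : ∀ u, ∃ D, IsLaminar D ∧ (∀ p ∈ D, (a ≤ p.1 ∧ p.2 ≤ b) ∧ p ≠ (a, b)) ∧
      l₁.Pairwise (TwistRel D u) ∧ l₂.Pairwise (TwistRel D u) ∧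
      ∀ x ∈ l₁, ∀ y ∈ l₂, x < y ∧ cover D x y = 0 := by
    intro u
    obtain ⟨D₁, hD₁, h₁, hp₁⟩ := ih₁ u
    obtain ⟨D₂, hD₂, h₂, hp₂⟩ := ih₂ u
    obtain ⟨hD, hd⟩ := hD₁.union hD₂ h₁ h₂
    refine ⟨D₁ ∪ D₂, hD, fun p hp => ?_, pairwise_union h₁ h₂ hd hs₁ hs₂ hp₁ hp₂⟩
    rw [ne_eq, Prod.ext_iff]
    rcases Finset.mem_union.1 hp with hp | hp
    · have := h₁ p hp
      omega
    · have := h₂ p hp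
      omega
  by_cases hst : Even s ↔ Even t
  · obtain ⟨D, hD, hab, hp₁, hp₂, hc⟩ := key s
    refine ⟨D, hD, fun p hp => (hab p hp).1, hp₁, hp₂, fun x hx y hy => ?_⟩
    obtain ⟨h1, h2⟩ := hc x hx y hy
    exact ⟨h1, by rwa [h2, zero_add]⟩
  · obtain ⟨D, hD, hab, hp₁, hp₂, hc⟩ := key (s + 1)
    have hnot : (a, b) ∉ D := fun h => (hab _ h).2 rfl
    have hcov : ∀ {x y : ℕ}, a ≤ x ∧ x < b → a ≤ y ∧ y < b →
        cover (insert (a, b) D) x y + s = cover D x y + (s + 1) := fun hx hy => by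
      rw [cover_insert hnot hx hy]
      ring
    refine ⟨insert (a, b) D, hD.insert (by omega) fun p hp => (hab p hp).1, fun p hp => ?_,
      hp₁.imp_of_mem fun {x y} hx hy h => ?_, hp₂.imp_of_mem fun {x y} hx hy h => ?_,
      fun x hx y hy => ?_⟩
    · rcases Finset.mem_insert.1 hp with rfl | hp
      exacts [⟨le_rfl, le_rfl⟩, (hab p hp).1]
    · rw [hs₁.mem_iff] at hx hy
      exact (TwistRel.congr (by rw [hcov (by omega) (by omega)])).2 h
    · rw [hs₂.mem_iff] at hx hy
      exact (TwistRel.congr (by rw [hcov (by omega) (by omega)])).2 h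
    · obtain ⟨h1, h2⟩ := hc x hx y hy
      rw [hs₁.mem_iff] at hx
      rw [hs₂.mem_iff] at hy
      refine ⟨h1, ?_⟩
      rw [hcov (by omega) (by omega), h2, zero_add, Nat.even_add_one]
      tauto

/-- Every separable list is obtained by twisting along a laminar family, with either sign. -/
theorem Separable.exists_isLaminar {a b : ℕ} {l : List ℕ} (h : Separable a b l) (s : ℕ) :
    ∃ D, IsLaminar D ∧ (∀ p ∈ D, a ≤ p.1 ∧ p.2 ≤ b) ∧ l.Pairwise (TwistRel D s) := by
  induction h generalizing s with
  | single a => exact ⟨∅, ⟨by simp, by simp⟩, by simp, by simp⟩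
  | sum hs₁ hs₂ ih₁ ih₂ =>
    obtain ⟨D, hD, hab, hp₁, hp₂, hc⟩ := exists_isLaminar_join hs₁ hs₂ ih₁ ih₂ s 0
    refine ⟨D, hD, hab, List.pairwise_append.2 ⟨hp₁, hp₂, fun x hx y hy => ?_⟩⟩
    obtain ⟨h1, h2⟩ := hc x hx y hy
    exact Or.inl ⟨h1, h2.2 (by decide)⟩
  | skew hs₁ hs₂ ih₁ ih₂ =>
    obtain ⟨D, hD, hab, hp₁, hp₂, hc⟩ := exists_isLaminar_join hs₁ hs₂ ih₁ ih₂ s 1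
    refine ⟨D, hD, hab, List.pairwise_append.2 ⟨hp₂, hp₁, fun y hy x hx => ?_⟩⟩
    obtain ⟨h1, h2⟩ := hc x hx y hy
    exact Or.inr ⟨h1, by rw [cover_comm, h2]; decide⟩

theorem card_insert_union {F₁ F₂ : Finset (ℕ × ℕ)} {a c b : ℕ} (hac : a < c) (hcb : c < b)
    (h₁ : ∀ p ∈ F₁, a ≤ p.1 ∧ p.2 ≤ c) (h₂ : ∀ p ∈ F₂, c ≤ p.1 ∧ p.2 ≤ b) (hd : Disjoint F₁ F₂) :
    (insert (a, b) (F₁ ∪ F₂)).card = F₁.card + F₂.card + 1 := by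
  rw [Finset.card_insert_of_notMem, Finset.card_union_of_disjoint hd]
  intro h
  rcases Finset.mem_union.1 h with h | h
  · have := h₁ _ h
    omega
  · have := h₂ _ h
    omega

/-- A separable list has a maximal laminar family of intervals occurring contiguously in it. -/
theorem Separable.exists_blocks {a b : ℕ} {l : List ℕ} (h : Separable a b l) :
    ∃ F, IsLaminar F ∧ (∀ p ∈ F, a ≤ p.1 ∧ p.2 ≤ b) ∧ F.card + a + 1 = b ∧
      (a + 2 ≤ b → (a, b) ∈ F) ∧
      ∀ p ∈ F, ∃ m, m <:+: l ∧ ∀ x, x ∈ m ↔ p.1 ≤ x ∧ x < p.2 := by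
  have join : ∀ {a c b : ℕ} {l₁ l₂ l : List ℕ}, Separable a c l₁ → Separable c b l₂ →
      (∃ F, IsLaminar F ∧ (∀ p ∈ F, a ≤ p.1 ∧ p.2 ≤ c) ∧ F.card + a + 1 = c ∧
        (a + 2 ≤ c → (a, c) ∈ F) ∧
        ∀ p ∈ F, ∃ m, m <:+: l₁ ∧ ∀ x, x ∈ m ↔ p.1 ≤ x ∧ x < p.2) →
      (∃ F, IsLaminar F ∧ (∀ p ∈ F, c ≤ p.1 ∧ p.2 ≤ b) ∧ F.card + c + 1 = b ∧
        (c + 2 ≤ b → (c, b) ∈ F) ∧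
        ∀ p ∈ F, ∃ m, m <:+: l₂ ∧ ∀ x, x ∈ m ↔ p.1 ≤ x ∧ x < p.2) →
      l₁ <:+: l → l₂ <:+: l → Separable a b l →
      ∃ F, IsLaminar F ∧ (∀ p ∈ F, a ≤ p.1 ∧ p.2 ≤ b) ∧ F.card + a + 1 = b ∧
        (a + 2 ≤ b → (a, b) ∈ F) ∧
        ∀ p ∈ F, ∃ m, m <:+: l ∧ ∀ x, x ∈ m ↔ p.1 ≤ x ∧ x < p.2 := by
    rintro a c b l₁ l₂ l hs₁ hs₂ ⟨F₁, hF₁, h₁, hc₁, -, hm₁⟩ ⟨F₂, hF₂, h₂, hc₂, -, hm₂⟩ hl₁ hl₂ hs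
    have hac := hs₁.lt
    have hcb := hs₂.lt
    obtain ⟨hF, hd⟩ := hF₁.union hF₂ h₁ h₂
    have hu : ∀ p ∈ F₁ ∪ F₂, a ≤ p.1 ∧ p.2 ≤ b := fun p hp => by
      rcases Finset.mem_union.1 hp with hp | hp
      · have := h₁ p hp
        omega
      · have := h₂ p hp
        omega
    refine ⟨insert (a, b) (F₁ ∪ F₂), hF.insert (by omega) hu, fun p hp => ?_, ?_,
      fun _ => Finset.mem_insert_self _ _, fun p hp => ?_⟩
    · rcases Finset.mem_insert.1 hp with rfl | hp
      exacts [⟨le_rfl, le_rfl⟩, hu p hp]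
    · rw [card_insert_union hac hcb h₁ h₂ hd]
      omega
    · rcases Finset.mem_insert.1 hp with rfl | hp
      · exact ⟨l, List.infix_rfl, fun x => hs.mem_iff⟩
      · rcases Finset.mem_union.1 hp with hp | hp
        · obtain ⟨m, hm, hx⟩ := hm₁ p hp
          exact ⟨m, hm.trans hl₁, hx⟩
        · obtain ⟨m, hm, hx⟩ := hm₂ p hp
          exact ⟨m, hm.trans hl₂, hx⟩
  induction h with
  | single a => exact ⟨∅, ⟨by simp, by simp⟩, by simp, by simp, by simp, by simp⟩
  | sum hs₁ hs₂ ih₁ ih₂ =>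
    exact join hs₁ hs₂ ih₁ ih₂ (List.prefix_append _ _).isInfix (List.suffix_append _ _).isInfix
      (hs₁.sum hs₂)
  | skew hs₁ hs₂ ih₁ ih₂ =>
    exact join hs₁ hs₂ ih₁ ih₂ (List.suffix_append _ _).isInfix (List.prefix_append _ _).isInfix
      (hs₁.skew hs₂)

theorem filter_or_eq_append {α : Type*} {P Q : α → Bool} {l : List α}
    (h : l.Pairwise fun x y => ¬ (Q x ∧ P y)) (hPQ : ∀ x, ¬ (P x ∧ Q x)) :
    (l.filter fun x => P x || Q x) = l.filter P ++ l.filter Q := by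
  induction l with
  | nil => rfl
  | cons x l ih =>
    rw [List.pairwise_cons] at h
    have := ih h.2
    have hx := hPQ x
    cases hP : P x <;> cases hQ : Q x
    · simp [hP, hQ, this]
    · have h0 : l.filter P = [] := by
        rw [List.filter_eq_nil_iff]
        exact fun y hy hPy => h.1 y hy ⟨hQ, hPy⟩
      simp [hP, hQ, this, h0]
    · simp [hP, hQ, this]
    · exact absurd ⟨hP, hQ⟩ hx

/-- The elements of `[a, b)` occur contiguously in `l`. -/
def IsConvexIn (l : List ℕ) (a b : ℕ) : Prop :=
  ∀ x y z, l.idxOf x < l.idxOf y → l.idxOf y < l.idxOf z → a ≤ x → x < b → a ≤ z → z < b →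
    a ≤ y ∧ y < b

theorem isConvexIn_of_infix {l m : List ℕ} {a b : ℕ} (hl : l.Nodup) (hm : m <:+: l)
    (h : ∀ x, x ∈ m ↔ a ≤ x ∧ x < b) : IsConvexIn l a b := by
  obtain ⟨s, t, rfl⟩ := hm
  intro x y z hxy hyz hax hxb haz hzb
  have hx := (h x).2 ⟨hax, hxb⟩
  have hz := (h z).2 ⟨haz, hzb⟩
  rw [← h]
  by_contra hy
  have hd := List.disjoint_of_nodup_append (List.nodup_append.1 hl).1
  rw [List.idxOf_append_of_mem (List.mem_append_right s hx),
    List.idxOf_append_of_notMem (fun h' => hd h' hx)] at hxy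
  rw [List.idxOf_append_of_mem (List.mem_append_right s hz),
    List.idxOf_append_of_notMem (fun h' => hd h' hz)] at hyz
  have hz' := List.idxOf_lt_length_of_mem hz
  by_cases hys : y ∈ s
  · rw [List.append_assoc, List.idxOf_append_of_mem hys] at hxy
    have := List.idxOf_lt_length_of_mem hys
    omega
  · rw [List.idxOf_append_of_notMem (by simp [hy, hys]), List.length_append] at hyz
    omega

theorem filter_eq_append_or {l : List ℕ} {a c b : ℕ} (hl : l.Nodup) (hac : a ≤ c) (hcb : c ≤ b)
    (h₁ : IsConvexIn l a c) (h₂ : IsConvexIn l c b) :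
    (l.filter fun x => a ≤ x ∧ x < b) =
        (l.filter fun x => a ≤ x ∧ x < c) ++ (l.filter fun x => c ≤ x ∧ x < b) ∨
      (l.filter fun x => a ≤ x ∧ x < b) =
        (l.filter fun x => c ≤ x ∧ x < b) ++ (l.filter fun x => a ≤ x ∧ x < c) := by
  have hpw : ∀ {a c b d : ℕ}, ¬ (l.Pairwise fun x y =>
      ¬ (decide (c ≤ x ∧ x < d) = true ∧ decide (a ≤ y ∧ y < b) = true)) →
      ∃ x y, (c ≤ x ∧ x < d) ∧ (a ≤ y ∧ y < b) ∧ l.idxOf x < l.idxOf y := by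
    intro a c b d h
    rw [List.pairwise_iff_getElem] at h
    push Not at h
    obtain ⟨i, j, hi, hj, hij, hx, hy⟩ := h
    refine ⟨l[i], l[j], of_decide_eq_true hx, of_decide_eq_true hy, ?_⟩
    rwa [hl.idxOf_getElem, hl.idxOf_getElem]
  by_cases hp : l.Pairwise fun x y =>
      ¬ (decide (c ≤ x ∧ x < b) = true ∧ decide (a ≤ y ∧ y < c) = true)
  · left
    rw [← filter_or_eq_append hp (fun x => by simp; omega)]
    congr 1
    funext x
    rw [Bool.eq_iff_iff]
    simp only [Bool.or_eq_true, decide_eq_true_eq]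
    omega
  by_cases hq : l.Pairwise fun x y =>
      ¬ (decide (a ≤ x ∧ x < c) = true ∧ decide (c ≤ y ∧ y < b) = true)
  · right
    rw [← filter_or_eq_append hq (fun x => by simp; omega)]
    congr 1
    funext x
    rw [Bool.eq_iff_iff]
    simp only [Bool.or_eq_true, decide_eq_true_eq]
    omega
  exfalso
  obtain ⟨y, x, hy, hx, hyx⟩ := hpw hp
  obtain ⟨x', y', hx', hy', hxy'⟩ := hpw hq
  by_cases h : l.idxOf x' < l.idxOf y
  · have := h₁ x' y x h hyx hx'.1 hx'.2 hx.1 hx.2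
    omega
  · have hne : l.idxOf y ≠ l.idxOf x' := fun h' => by
      have := List.idxOf_lt_length_iff.1
        (hyx.trans_le List.idxOf_le_length)
      have := (List.idxOf_inj this).1 h'
      omega
    have := h₂ y x' y' (by omega) hxy' hy.1 hy.2 hy'.1 hy'.2
    omega

/-- A laminar family of intervals in `[a, b)` has at most `b - a - 1` members, and if it attains
this bound, then a list in which all its members are contiguous is separable. -/
theorem separable_of_blocks {l : List ℕ} (hl : l.Nodup) {F : Finset (ℕ × ℕ)} {a b : ℕ}
    (hab : a < b) (hmem : ∀ x, a ≤ x → x < b → x ∈ l) (hF : IsLaminar F)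
    (hFab : ∀ p ∈ F, a ≤ p.1 ∧ p.2 ≤ b) (hconv : ∀ p ∈ F, IsConvexIn l p.1 p.2) :
    F.card + a + 1 ≤ b ∧ (b ≤ F.card + a + 1 →
      (a + 2 ≤ b → (a, b) ∈ F) ∧ Separable a b (l.filter fun x => a ≤ x ∧ x < b)) := by
  obtain ⟨k, hk⟩ : ∃ k, b = a + k := ⟨b - a, by omega⟩
  induction k using Nat.strong_induction_on generalizing a b F with
  | _ k ih =>
    by_cases hab2 : b = a + 1
    · subst hab2
      have h0 : F = ∅ := Finset.eq_empty_of_forall_notMem fun p hp => by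
        have := hFab p hp
        have := hF.two_le p hp
        omega
      have h1 : (l.filter fun x => a ≤ x ∧ x < a + 1) = [a] := by
        rw [← List.perm_singleton, List.perm_ext_iff_of_nodup (hl.filter _) (by simp)]
        intro x
        simp only [List.mem_filter, decide_eq_true_eq, List.mem_singleton]
        exact ⟨fun h => by omega, fun h => ⟨hmem x (by omega) (by omega), by omega⟩⟩
      rw [h1, h0]
      exact ⟨by simp, fun _ => ⟨by omega, .single a⟩⟩
    obtain ⟨c, hac, hcb, hc⟩ := hF.exists_split (by omega : a + 2 ≤ b) fun p hp => by
      have := hFab p hp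
      unfold Crosses
      omega
    have hs₁ : F.filter (fun p => p.2 ≤ c) ⊆ F := Finset.filter_subset _ _
    have hs₂ : F.filter (fun p => c ≤ p.1) ⊆ F := Finset.filter_subset _ _
    have hb₁ : ∀ p ∈ F.filter (fun p => p.2 ≤ c), a ≤ p.1 ∧ p.2 ≤ c := fun p hp =>
      ⟨(hFab p (hs₁ hp)).1, (Finset.mem_filter.1 hp).2⟩
    have hb₂ : ∀ p ∈ F.filter (fun p => c ≤ p.1), c ≤ p.1 ∧ p.2 ≤ b := fun p hp =>
      ⟨(Finset.mem_filter.1 hp).2, (hFab p (hs₂ hp)).2⟩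
    have ih₁ := ih (c - a) (by omega) hac (fun x h1 h2 => hmem x h1 (by omega)) (hF.mono hs₁) hb₁
      (fun p hp => hconv p (hs₁ hp)) (by omega)
    have ih₂ := ih (b - c) (by omega) hcb (fun x h1 h2 => hmem x (by omega) h2) (hF.mono hs₂) hb₂
      (fun p hp => hconv p (hs₂ hp)) (by omega)
    have hd := ((hF.mono hs₁).union (hF.mono hs₂) hb₁ hb₂).2
    have hcard := card_insert_union hac hcb hb₁ hb₂ hd
    have hsub : F ⊆ insert (a, b)
        (F.filter (fun p => p.2 ≤ c) ∪ F.filter (fun p => c ≤ p.1)) := fun p hp => by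
      simp only [Finset.mem_insert, Finset.mem_union, Finset.mem_filter, Prod.ext_iff]
      have := hc p hp
      have := hFab p hp
      have : p.1 = a ∧ p.2 = b ∨ p.2 ≤ c ∨ c ≤ p.1 := by omega
      tauto
    have hle := Finset.card_le_card hsub
    refine ⟨by omega, fun hb => ?_⟩
    have heq := Finset.eq_of_subset_of_card_le hsub (by omega)
    obtain ⟨ht₁, hsep₁⟩ := ih₁.2 (by omega)
    obtain ⟨ht₂, hsep₂⟩ := ih₂.2 (by omega)
    have hconv_single : ∀ u, IsConvexIn l u (u + 1) := by
      intro u x y z h1 h2 h3 h4 h5 h6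
      obtain rfl : x = z := by omega
      omega
    have hconv₁ : IsConvexIn l a c := by
      by_cases h : a + 2 ≤ c
      · exact hconv _ (hs₁ (ht₁ h))
      · obtain rfl : c = a + 1 := by omega
        exact hconv_single a
    have hconv₂ : IsConvexIn l c b := by
      by_cases h : c + 2 ≤ b
      · exact hconv _ (hs₂ (ht₂ h))
      · obtain rfl : b = c + 1 := by omega
        exact hconv_single c
    refine ⟨fun _ => by rw [heq]; exact Finset.mem_insert_self _ _, ?_⟩
    rcases filter_eq_append_or hl hac.le hcb.le hconv₁ hconv₂ with h | h
    · rw [h]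
      exact hsep₁.sum hsep₂
    · rw [h]
      exact hsep₁.skew hsep₂

theorem isArc_of_infix {l m : List ℕ} (h : m <:+: l) : IsArc l m.toFinset := by
  obtain ⟨s, t, rfl⟩ := h
  refine ⟨s.length, m.length, ?_⟩
  rw [List.append_assoc, List.rotate_append_length_eq, List.append_assoc, List.take_left]

theorem IsArc.sdiff {l : List ℕ} {A : Finset ℕ} (hl : l.Nodup) (h : IsArc l A) :
    IsArc l (l.toFinset \ A) := by
  obtain ⟨k, m, rfl⟩ := h
  obtain ⟨l', hl'⟩ : ∃ l', l' = l.rotate k := ⟨_, rfl⟩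
  have hn : l'.Nodup := by rw [hl']; exact List.nodup_rotate.2 hl
  have hset : l.toFinset = l'.toFinset := by
    ext x
    simp [hl']
  have hdrop : l'.toFinset \ (l'.take m).toFinset = (l'.drop m).toFinset := by
    have hd := List.disjoint_take_drop hn le_rfl (m := m)
    ext x
    rw [Finset.mem_sdiff, List.mem_toFinset, List.mem_toFinset, List.mem_toFinset]
    constructor
    · rintro ⟨h1, h2⟩
      rw [← List.take_append_drop m l', List.mem_append] at h1
      exact h1.resolve_left h2
    · exact fun h => ⟨List.mem_of_mem_drop h, fun h' => hd h' h⟩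
  obtain ⟨i, j, hij⟩ := isArc_of_infix (List.drop_suffix m l').isInfix
  refine ⟨k + i, j, ?_⟩
  rw [hset, ← hl', hdrop, hij, hl', List.rotate_rotate]

theorem IsArc.of_isRotated {l l' : List ℕ} {A : Finset ℕ} (h : IsArc l A) (hl : l' ~r l) :
    IsArc l' A := by
  obtain ⟨j, rfl⟩ := hl
  obtain ⟨k, m, rfl⟩ := h
  exact ⟨j + k, m, by rw [List.rotate_rotate]⟩

theorem IsArc.exists_infix {l : List ℕ} {z : ℕ} {A : Finset ℕ} (h : IsArc (l ++ [z]) A)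
    (hz : z ∉ A) : ∃ m, m <:+: l ∧ ∀ x, x ∈ m ↔ x ∈ A := by
  obtain ⟨k, m, rfl⟩ := h
  rw [List.mem_toFinset] at hz
  refine ⟨((l ++ [z]).rotate k).take m, ?_, fun x => by rw [List.mem_toFinset]⟩
  rw [List.rotate_eq_drop_append_take_mod] at hz ⊢
  have hk : k % (l ++ [z]).length ≤ l.length := by
    have := Nat.mod_lt k (show 0 < (l ++ [z]).length by simp)
    simp only [List.length_append, List.length_singleton] at this ⊢
    omega
  generalize k % (l ++ [z]).length = i at *
  rw [List.drop_append_of_le_length hk, List.append_assoc, List.take_append] at hz ⊢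
  rw [List.mem_append, not_or] at hz
  have h0 : m - (l.drop i).length = 0 := by
    by_contra h0
    apply hz.2
    obtain ⟨j, hj⟩ := Nat.exists_eq_succ_of_ne_zero h0
    rw [hj]
    simp
  rw [h0, List.take_zero, List.append_nil]
  exact (List.take_prefix _ _).isInfix.trans (List.drop_suffix _ _).isInfix

theorem mem_iff_of_infix_range {m : List ℕ} {N : ℕ} (h : m <:+: List.range N) :
    ∃ a b, a ≤ b ∧ b ≤ N ∧ ∀ x, x ∈ m ↔ a ≤ x ∧ x < b := by
  obtain ⟨s, t, h⟩ := h
  have hlen := congrArg List.length h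
  simp only [List.length_append, List.length_range] at hlen
  refine ⟨s.length, s.length + m.length, by omega, by omega, fun x => ?_⟩
  have hm : m = ((List.range N).drop s.length).take m.length := by
    rw [← h, List.append_assoc, List.drop_left, List.take_left]
  rw [hm, List.mem_iff_getElem]
  simp only [List.getElem_take, List.getElem_drop, List.getElem_range, List.length_take,
    List.length_drop, List.length_range]
  constructor
  · rintro ⟨i, hi, rfl⟩
    omega
  · intro hx
    exact ⟨x - s.length, by omega, by omega⟩

theorem infix_range {a b N : ℕ} (hab : a ≤ b) (hb : b ≤ N) :
    ((List.range N).drop a).take (b - a) <:+: List.range N ∧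
      (((List.range N).drop a).take (b - a)).toFinset = Finset.Ico a b := by
  refine ⟨(List.take_prefix _ _).isInfix.trans (List.drop_suffix _ _).isInfix, ?_⟩
  ext x
  rw [List.mem_toFinset, List.mem_iff_getElem, Finset.mem_Ico]
  simp only [List.getElem_take, List.getElem_drop, List.getElem_range, List.length_take,
    List.length_drop, List.length_range]
  constructor
  · rintro ⟨i, hi, rfl⟩
    omega
  · intro hx
    exact ⟨x - a, by omega, by omega⟩

theorem IsTreeSplits.card_filter {L : Finset ℕ} {T : Finset (Finset ℕ)} (hT : IsTreeSplits L T)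
    {z : ℕ} (hz : z ∈ L) : (T.filter fun A => z ∉ A).card = L.card - 3 := by
  obtain ⟨h1, h2, -, h4⟩ := hT
  have h5 : (T.filter fun A => z ∈ A).card = (T.filter fun A => z ∉ A).card := by
    refine Finset.card_nbij' (L \ ·) (L \ ·) ?_ ?_ ?_ ?_
    · intro A hA
      simp only [Finset.coe_filter, Set.mem_ofPred_eq] at hA ⊢
      exact ⟨h2 A hA.1, by simp [hA.2]⟩
    · intro A hA
      simp only [Finset.coe_filter, Set.mem_ofPred_eq] at hA ⊢
      exact ⟨h2 A hA.1, by simp [hA.2, hz]⟩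
    · intro A hA
      exact Finset.sdiff_sdiff_eq_self (h1 A (Finset.mem_filter.1 hA).1).1
    · intro A hA
      exact Finset.sdiff_sdiff_eq_self (h1 A (Finset.mem_filter.1 hA).1).1
  have h6 := Finset.card_filter_add_card_filter_not (s := T) (fun A => z ∈ A)
  omega

/-- If `l ++ [N]` shares a planar tree with the standard ordering, then `l` is separable. -/
theorem separable_of_isTreeSplits {l : List ℕ} {N : ℕ} (hN : 2 ≤ N)
    (hl : IsOrdering (Finset.range (N + 1)) (l ++ [N])) {T : Finset (Finset ℕ)}
    (hT : IsTreeSplits (Finset.range (N + 1)) T) (hP : Planar (List.range (N + 1)) T)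
    (hPl : Planar (l ++ [N]) T) : Separable 0 N l := by
  have hnd : l.Nodup := (List.nodup_append.1 hl.1).1
  have hmem : ∀ x, x ∈ l ↔ x < N := fun x => by
    have h1 := congrArg (x ∈ ·) hl.2
    have h2 : x ∈ l → x ≠ N := fun h => (List.nodup_append.1 hl.1).2.2 x h N (by simp)
    simp only [List.toFinset_append, Finset.mem_union, List.mem_toFinset, List.mem_singleton,
      Finset.mem_range, eq_iff_iff] at h1
    constructor
    · intro h
      have := h1.1 (Or.inl h)
      have := h2 h
      omega
    · intro h
      exact (h1.2 (by omega)).resolve_right (by omega)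
  let F : Finset (ℕ × ℕ) := (Finset.range (N + 1) ×ˢ Finset.range (N + 1)).filter
    fun p => p.1 < p.2 ∧ Finset.Ico p.1 p.2 ∈ T
  have hF : ∀ p ∈ F, p.1 < p.2 ∧ p.2 ≤ N ∧ Finset.Ico p.1 p.2 ∈ T := fun p hp => by
    simp only [F, Finset.mem_filter, Finset.mem_product, Finset.mem_range] at hp
    exact ⟨hp.2.1, by omega, hp.2.2⟩
  have hcard : N - 2 ≤ F.card := by
    have h1 := hT.card_filter (z := N) (by simp)
    rw [Finset.card_range, show N + 1 - 3 = N - 2 by omega] at h1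
    rw [← h1]
    refine le_trans (Finset.card_le_card ?_)
      (Finset.card_image_le (s := F) (f := fun p => Finset.Ico p.1 p.2))
    intro A hA
    rw [Finset.mem_filter] at hA
    have hA1 := hP A hA.1
    rw [List.range_succ] at hA1
    obtain ⟨m, hm, hmA⟩ := hA1.exists_infix hA.2
    obtain ⟨a, b, hab, hb, hx⟩ := mem_iff_of_infix_range hm
    have hA2 : A = Finset.Ico a b := by
      ext x
      rw [← hmA, hx, Finset.mem_Ico]
    have hA3 := (hT.1 A hA.1).2.1
    rw [hA2, Nat.card_Ico] at hA3
    rw [Finset.mem_image]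
    refine ⟨(a, b), ?_, hA2.symm⟩
    simp only [F, Finset.mem_filter, Finset.mem_product, Finset.mem_range]
    exact ⟨by omega, by omega, hA2 ▸ hA.1⟩
  have hcross : ∀ p ∈ F, ∀ q ∈ F, ¬ (p.1 < q.1 ∧ q.1 < p.2 ∧ p.2 < q.2) := by
    intro p hp q hq hpq
    obtain ⟨hp1, hp2, hp3⟩ := hF p hp
    obtain ⟨hq1, hq2, hq3⟩ := hF q hq
    rcases hT.2.2.1 _ hp3 _ hq3 with h | h | h | h
    · have := @h p.1 (by rw [Finset.mem_Ico]; omega)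
      rw [Finset.mem_Ico] at this
      omega
    · have := @h p.2 (by rw [Finset.mem_Ico]; omega)
      rw [Finset.mem_Ico] at this
      omega
    · have : q.1 ∈ Finset.Ico p.1 p.2 ∩ Finset.Ico q.1 q.2 := by
        rw [Finset.mem_inter, Finset.mem_Ico, Finset.mem_Ico]
        omega
      rw [h] at this
      simp at this
    · have := @h N (by simp)
      rw [Finset.mem_union, Finset.mem_Ico, Finset.mem_Ico] at this
      omega
  have hlam : IsLaminar F := by
    refine ⟨fun p hp => ?_, fun p hp q hq h => ?_⟩
    · have := (hT.1 _ (hF p hp).2.2).2.1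
      rw [Nat.card_Ico] at this
      omega
    · exact h.elim (hcross p hp q hq) (hcross q hq p hp)
  have hroot : (0, N) ∉ F := fun h => by
    have := (hT.1 _ (hF _ h).2.2).2.2
    rw [Nat.card_Ico, Finset.card_range] at this
    omega
  have hb : ∀ p ∈ F, 0 ≤ p.1 ∧ p.2 ≤ N := fun p hp => ⟨Nat.zero_le _, (hF p hp).2.1⟩
  have hsep := (separable_of_blocks hnd (by omega : 0 < N) (fun x _ hx => (hmem x).2 hx)
    (hlam.insert (by omega) hb) (fun p hp => ?_) (fun p hp => ?_)).2 (by
      rw [Finset.card_insert_of_notMem hroot]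
      omega)
  · have hfil : (l.filter fun x => 0 ≤ x ∧ x < N) = l := by
      rw [List.filter_eq_self]
      intro x hx
      simpa using (hmem x).1 hx
    rw [← hfil]
    exact hsep.2
  · rcases Finset.mem_insert.1 hp with rfl | hp
    exacts [⟨le_rfl, le_rfl⟩, hb p hp]
  · rcases Finset.mem_insert.1 hp with rfl | hp
    · exact isConvexIn_of_infix hnd List.infix_rfl fun x => by simp [hmem]
    · obtain ⟨m, hm, hx⟩ := (hPl _ (hF p hp).2.2).exists_infix (by
        rw [Finset.mem_Ico]
        have := hF p hp
        omega)
      exact isConvexIn_of_infix hnd hm fun x => by rw [hx, Finset.mem_Ico]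

theorem Separable.isOrdering {l : List ℕ} {N : ℕ} (h : Separable 0 N l) :
    IsOrdering (Finset.range (N + 1)) (l ++ [N]) := by
  refine ⟨h.nodup.append (by simp) fun x hx hx' => ?_, ?_⟩
  · rw [h.mem_iff] at hx
    rw [List.mem_singleton] at hx'
    omega
  · ext x
    simp only [List.toFinset_append, Finset.mem_union, List.mem_toFinset, List.mem_singleton,
      Finset.mem_range, h.mem_iff]
    omega

theorem compatible_sdiff {L A B : Finset ℕ} (hA : A ⊆ L)
    (h : A ⊆ B ∨ B ⊆ A ∨ A ∩ B = ∅ ∨ L ⊆ A ∪ B) :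
    A ⊆ L \ B ∨ L \ B ⊆ A ∨ A ∩ (L \ B) = ∅ ∨ L ⊆ A ∪ (L \ B) := by
  rcases h with h | h | h | h
  · right; right; left
    ext x
    have := @h x
    simp
    tauto
  · right; right; right
    intro x hx
    have := @h x
    simp
    tauto
  · left
    intro x hx
    have h1 : x ∉ A ∩ B := by simp [h]
    have := @hA x
    simp at h1 ⊢
    tauto
  · right; left
    intro x hx
    have := @h x
    simp at hx this
    tauto

theorem compatible_comm {L A B : Finset ℕ}
    (h : A ⊆ B ∨ B ⊆ A ∨ A ∩ B = ∅ ∨ L ⊆ A ∪ B) :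
    B ⊆ A ∨ A ⊆ B ∨ B ∩ A = ∅ ∨ L ⊆ B ∪ A := by
  rw [Finset.inter_comm, Finset.union_comm]
  tauto

/-- If `l` is separable, then `l ++ [N]` shares a planar tree with the standard ordering. -/
theorem Separable.exists_isTreeSplits {l : List ℕ} {N : ℕ} (hN : 2 ≤ N) (h : Separable 0 N l) :
    ∃ T, IsTreeSplits (Finset.range (N + 1)) T ∧ Planar (List.range (N + 1)) T ∧
      Planar (l ++ [N]) T := by
  obtain ⟨F, hF, hb, hcard, hroot, hm⟩ := h.exists_blocks
  let L := Finset.range (N + 1)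
  obtain ⟨T₀, hT₀_eq⟩ : ∃ T₀ : Finset (Finset ℕ),
      T₀ = (F.erase (0, N)).image fun p => Finset.Ico p.1 p.2 := ⟨_, rfl⟩
  have hT₀_card : T₀.card = N - 2 := by
    rw [hT₀_eq, Finset.card_image_of_injOn, Finset.card_erase_of_mem (hroot (by omega))]
    · omega
    intro p hp q hq hpq
    have h1 := hF.two_le p (Finset.mem_of_mem_erase hp)
    have h2 := hF.two_le q (Finset.mem_of_mem_erase hq)
    have h3 : ∀ x, x ∈ Finset.Ico p.1 p.2 ↔ x ∈ Finset.Ico q.1 q.2 := fun x => by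
      simp only at hpq
      rw [hpq]
    simp only [Finset.mem_Ico] at h3
    have := h3 p.1
    have := h3 q.1
    have := h3 (p.2 - 1)
    have := h3 (q.2 - 1)
    rw [Prod.ext_iff]
    omega
  have hT₀ : ∀ A ∈ T₀, ∃ p ∈ F, p ≠ (0, N) ∧ Finset.Ico p.1 p.2 = A := fun A hA => by
    rw [hT₀_eq] at hA
    obtain ⟨p, hp, hpA⟩ := Finset.mem_image.1 hA
    rw [Finset.mem_erase] at hp
    exact ⟨p, hp.2, hp.1, hpA⟩
  have hsub : ∀ A ∈ T₀, A ⊆ L ∧ N ∉ A ∧ 2 ≤ A.card ∧ A.card + 2 ≤ N + 1 := fun A hA => by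
    obtain ⟨p, hp, hp0, rfl⟩ := hT₀ A hA
    have h1 := hb p hp
    have h2 := hF.two_le p hp
    rw [ne_eq, Prod.ext_iff] at hp0
    simp only at hp0
    refine ⟨fun x hx => ?_, ?_, ?_⟩
    · rw [Finset.mem_Ico] at hx
      rw [Finset.mem_range]
      omega
    · rw [Finset.mem_Ico]
      omega
    · rw [Nat.card_Ico]
      omega
  have hcomp : ∀ A ∈ T₀, ∀ B ∈ T₀, A ⊆ B ∨ B ⊆ A ∨ A ∩ B = ∅ ∨ L ⊆ A ∪ B := by
    intro A hA B hB
    obtain ⟨p, hp, -, rfl⟩ := hT₀ A hA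
    obtain ⟨q, hq, -, rfl⟩ := hT₀ B hB
    have h1 := hF.not_crosses p hp q hq
    unfold Crosses at h1
    have h2 : (q.1 ≤ p.1 ∧ p.2 ≤ q.2) ∨ (p.1 ≤ q.1 ∧ q.2 ≤ p.2) ∨ p.2 ≤ q.1 ∨ q.2 ≤ p.1 := by
      omega
    rcases h2 with h2 | h2 | h2
    · exact Or.inl (Finset.Ico_subset_Ico h2.1 h2.2)
    · exact Or.inr (Or.inl (Finset.Ico_subset_Ico h2.1 h2.2))
    · refine Or.inr (Or.inr (Or.inl ?_))
      ext x
      simp only [Finset.mem_inter, Finset.mem_Ico, Finset.notMem_empty, iff_false]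
      omega
  have harc : ∀ A ∈ T₀, IsArc (List.range (N + 1)) A ∧ IsArc (l ++ [N]) A := by
    intro A hA
    obtain ⟨p, hp, -, rfl⟩ := hT₀ A hA
    have h1 := hF.two_le p hp
    have h2 := hb p hp
    constructor
    · obtain ⟨h3, h4⟩ := infix_range (by omega : p.1 ≤ p.2) (by omega : p.2 ≤ N + 1)
      rw [← h4]
      exact isArc_of_infix h3
    · obtain ⟨m, h3, h4⟩ := hm p hp
      have h5 : Finset.Ico p.1 p.2 = m.toFinset := by
        ext x
        rw [List.mem_toFinset, h4, Finset.mem_Ico]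
      rw [h5]
      exact isArc_of_infix (h3.trans (List.prefix_append _ _).isInfix)
  have hcases : ∀ A ∈ T₀ ∪ T₀.image (L \ ·), A ∈ T₀ ∨ ∃ B ∈ T₀, L \ B = A := fun A hA => by
    rw [Finset.mem_union, Finset.mem_image] at hA
    exact hA
  have hdd : ∀ A ∈ T₀, L \ (L \ A) = A := fun A hA => Finset.sdiff_sdiff_eq_self (hsub A hA).1
  refine ⟨T₀ ∪ T₀.image (L \ ·), ⟨fun A hA => ?_, fun A hA => ?_, fun A hA' B hB' => ?_, ?_⟩,
    fun A hA => ?_, fun A hA => ?_⟩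
  · rw [Finset.card_range]
    rcases hcases A hA with hA | ⟨B, hB, rfl⟩
    · obtain ⟨h1, -, h2⟩ := hsub A hA
      exact ⟨h1, h2⟩
    · obtain ⟨h1, -, h2⟩ := hsub B hB
      refine ⟨Finset.sdiff_subset, ?_⟩
      rw [Finset.card_sdiff_of_subset h1, Finset.card_range]
      omega
  · rw [Finset.mem_union, Finset.mem_image]
    rcases hcases A hA with hA | ⟨B, hB, rfl⟩
    · exact Or.inr ⟨A, hA, rfl⟩
    · left
      change L \ (L \ B) ∈ T₀
      rwa [hdd B hB]
  · rcases hcases A hA' with hA | ⟨A, hA, rfl⟩ <;>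
      rcases hcases B hB' with hB | ⟨B, hB, rfl⟩
    · exact hcomp A hA B hB
    · exact compatible_sdiff (hsub A hA).1 (hcomp A hA B hB)
    · exact compatible_comm
        (compatible_sdiff (hsub B hB).1 (hcomp B hB A hA))
    · exact compatible_sdiff Finset.sdiff_subset (compatible_comm
        (compatible_sdiff (hsub B hB).1 (hcomp B hB A hA)))
  · rw [Finset.card_union_of_disjoint, Finset.card_image_of_injOn, hT₀_card, Finset.card_range]
    · omega
    · intro A hA B hB hAB
      simp only at hAB
      rw [← hdd A hA, hAB, hdd B hB]
    · rw [Finset.disjoint_left]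
      intro A hA hA'
      obtain ⟨B, hB, rfl⟩ := Finset.mem_image.1 hA'
      refine (hsub _ hA).2.1 (Finset.mem_sdiff.2 ⟨?_, (hsub B hB).2.1⟩)
      simp [L]
  · rcases hcases A hA with hA | ⟨B, hB, rfl⟩
    · exact (harc A hA).1
    · have := (harc B hB).1.sdiff List.nodup_range
      rwa [List.toFinset_range] at this
  · rcases hcases A hA with hA | ⟨B, hB, rfl⟩
    · exact (harc A hA).2
    · have := (harc B hB).2.sdiff h.isOrdering.1
      rwa [h.isOrdering.2] at this

theorem Separable.reverse {a b : ℕ} {l : List ℕ} (h : Separable a b l) :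
    Separable a b l.reverse := by
  induction h with
  | single a => exact .single a
  | sum _ _ ih₁ ih₂ =>
    rw [List.reverse_append]
    exact ih₁.skew ih₂
  | skew _ _ ih₁ ih₂ =>
    rw [List.reverse_append]
    exact ih₁.sum ih₂

theorem Separable.eq_of_pairwise {a b s : ℕ} {l l' : List ℕ} {D : Finset (ℕ × ℕ)}
    (h : Separable a b l) (h' : Separable a b l') (hp : l.Pairwise (TwistRel D s))
    (hp' : l'.Pairwise (TwistRel D s)) : l = l' :=
  List.Perm.eq_of_pairwise (fun _ _ _ _ h1 h2 => absurd h2 h1.asymm) hp hp'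
    ((List.perm_ext_iff_of_nodup h.nodup h'.nodup).2 fun x => by rw [h.mem_iff, h'.mem_iff])

/-- Up to reversal, a separable list is obtained by twisting along a laminar family of proper
intervals. -/
theorem Separable.exists_isLaminar_proper {N : ℕ} {l : List ℕ} (h : Separable 0 N l) :
    ∃ D, IsLaminar D ∧ (∀ p ∈ D, p.2 ≤ N) ∧ (0, N) ∉ D ∧
      (l.Pairwise (TwistRel D 0) ∨ l.reverse.Pairwise (TwistRel D 0)) := by
  obtain ⟨D, hD, hb, hp⟩ := h.exists_isLaminar 0
  by_cases h0 : (0, N) ∈ D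
  · refine ⟨D.erase (0, N), hD.mono (Finset.erase_subset _ _),
      fun p hp => (hb p (Finset.mem_of_mem_erase hp)).2, Finset.notMem_erase _ _, Or.inr ?_⟩
    rw [List.pairwise_reverse]
    refine hp.imp_of_mem fun {x y} hx hy hxy => ?_
    rw [h.mem_iff] at hx hy
    rw [← Finset.insert_erase h0] at hxy
    refine (TwistRel.congr ?_).2 hxy.swap
    rw [cover_insert (Finset.notMem_erase _ _) hy hx, add_zero, zero_add, add_assoc,
      Nat.even_add]
    simp
  · exact ⟨D, hD, fun p hp => (hb p hp).2, h0, Or.inl hp⟩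

theorem eq_of_append_singleton_isRotated {α : Type*} {l l' : List α} {z : α}
    (hl : (l ++ [z]).Nodup) (h : l ++ [z] ~r l' ++ [z]) : l = l' := by
  have h1 : z :: l ~r z :: l' :=
    (List.isRotated_append (l := [z]) (l' := l)).trans
      (h.trans (List.isRotated_append (l := l') (l' := [z])))
  obtain ⟨k, hk, hkl⟩ := List.isRotated_iff_mod.1 h1
  have hn : (z :: l).Nodup := (List.isRotated_append (l := [z]) (l' := l)).nodup_iff.2 hl
  rcases Nat.eq_zero_or_pos k with rfl | hk0
  · simpa using hkl
  rcases hk.eq_or_lt with rfl | hk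
  · simpa using hkl
  have h2 := congrArg (fun m => m[0]?) hkl
  simp only [List.getElem?_cons_zero, List.getElem?_rotate (show 0 < (z :: l).length by simp),
    zero_add, Nat.mod_eq_of_lt hk] at h2
  obtain ⟨h3, h4⟩ := List.getElem?_eq_some_iff.1 h2
  have := (hn.getElem_inj_iff (i := k) (j := 0) (hi := hk) (hj := by simp)).1 (by simpa using h4)
  omega

theorem exists_append_singleton_isRotated {α : Type*} {l : List α} {z : α} (h : z ∈ l) :
    ∃ l', l' ++ [z] ~r l := by
  obtain ⟨s, t, rfl⟩ := List.append_of_mem h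
  refine ⟨t ++ s, ?_⟩
  have := List.isRotated_append (l := t) (l' := s ++ [z])
  simpa using this

/-- Twisting along two laminar families of proper intervals cannot give opposite orders. -/
theorem not_pairwise_reverse {D E : Finset (ℕ × ℕ)} {N : ℕ} {l : List ℕ} (hN : 2 ≤ N)
    (hD : ∀ p ∈ D, p.2 ≤ N) (hE : ∀ p ∈ E, p.2 ≤ N) (hD0 : (0, N) ∉ D) (hE0 : (0, N) ∉ E)
    (h : Separable 0 N l) (hl : l.Pairwise (TwistRel D 0))
    (hl' : l.reverse.Pairwise (TwistRel E 0)) : False := by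
  have hz : ∀ {G : Finset (ℕ × ℕ)}, (∀ p ∈ G, p.2 ≤ N) → (0, N) ∉ G → cover G 0 (N - 1) = 0 := by
    intro G hG hG0
    refine cover_eq_zero fun p hp hp' => hG0 ?_
    have := hG p hp
    have hpN : p = (0, N) := Prod.ext (by simp only; omega) (by simp only; omega)
    rwa [← hpN]
  rw [List.pairwise_reverse] at hl'
  have h2 := even_cover_iff_of_pairwise hl (hl'.imp fun {x y} hxy => hxy.swap)
    (h.mem_iff.2 (by omega : 0 ≤ 0 ∧ 0 < N)) (h.mem_iff.2 (by omega : 0 ≤ N - 1 ∧ N - 1 < N))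
    (by omega)
  rw [hz hD hD0, hz hE hE0] at h2
  simp at h2

theorem dihedral_iff {l l' : List ℕ} :
    (∃ k : ℕ, l' = l.rotate k ∨ l' = (l.rotate k).reverse) ↔ l ~r l' ∨ l ~r l'.reverse := by
  rw [exists_or]
  refine or_congr (exists_congr fun k => eq_comm) (exists_congr fun k => ?_)
  rw [eq_comm, List.reverse_eq_iff]

theorem dihedral_equivalence {P : List ℕ → Prop} : Equivalence (fun l₁ l₂ : {l : List ℕ // P l} =>
    ∃ k : ℕ, l₂.1 = l₁.1.rotate k ∨ l₂.1 = (l₁.1.rotate k).reverse) where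
  refl l := ⟨0, by simp⟩
  symm {l₁ l₂} h := by
    rw [dihedral_iff] at h ⊢
    rcases h with h | h
    · exact Or.inl h.symm
    · exact Or.inr (by simpa using h.reverse.symm)
  trans {l₁ l₂ l₃} h h' := by
    rw [dihedral_iff] at h h' ⊢
    rcases h with h | h <;> rcases h' with h' | h'
    · exact Or.inl (h.trans h')
    · exact Or.inr (h.trans h')
    · exact Or.inr (h.trans h'.reverse)
    · exact Or.inl (h.trans (by simpa using h'.reverse))

/-- The number of cyclic orderings `β` of `{0,...,n-1}` (up to rotation and reflection)
sharing at least one common planar unrooted binary tree with the standard ordering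
`(0,1,...,n-1)` equals the super Catalan number `S_{n-1}`, for `n ≥ 4`. -/
theorem card_compatible_with_standard (n : ℕ) (hn : 4 ≤ n) :
    Nat.card (Quot (fun (l₁ l₂ : {l : List ℕ // IsOrdering (Finset.range n) l ∧
        ∃ T : Finset (Finset ℕ), IsTreeSplits (Finset.range n) T ∧
          Planar (List.range n) T ∧ Planar l T}) =>
      ∃ k : ℕ, l₂.1 = l₁.1.rotate k ∨ l₂.1 = (l₁.1.rotate k).reverse)) =
      superCatalan (n - 1) := by
  obtain ⟨N, rfl⟩ : ∃ N, n = N + 1 := ⟨n - 1, by omega⟩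
  rw [superCatalan, Nat.add_sub_cancel]
  have hdis : ∀ D : {D : Finset (ℕ × ℕ) //
      (∀ p ∈ D, IsDiagonal (N + 1) p) ∧ ∀ p ∈ D, ∀ q ∈ D, ¬ Crosses p q},
      IsLaminar D.1 ∧ (∀ p ∈ D.1, p.2 ≤ N) ∧ (0, N) ∉ D.1 := fun D =>
    ⟨⟨fun p hp => (D.2.1 p hp).1, D.2.2⟩, fun p hp => (D.2.1 p hp).2.1,
      fun h => (D.2.1 _ h).2.2 ⟨rfl, rfl⟩⟩
  have hex : ∀ D : {D : Finset (ℕ × ℕ) //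
      (∀ p ∈ D, IsDiagonal (N + 1) p) ∧ ∀ p ∈ D, ∀ q ∈ D, ¬ Crosses p q},
      ∃ l, Separable 0 N l ∧ l.Pairwise (TwistRel D.1 0) := fun D => by
    obtain ⟨h1, h2, -⟩ := hdis D
    refine h1.exists_separable (by omega) fun p hp => ?_
    have := h2 p hp
    unfold Crosses
    omega
  choose f hf hfp using hex
  symm
  refine Nat.card_eq_of_bijective (fun D => Quot.mk _ ⟨f D ++ [N], (hf D).isOrdering,
    (hf D).exists_isTreeSplits (by omega)⟩) ⟨fun D E hDE => ?_, fun q => ?_⟩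
  · have hr := dihedral_equivalence.eqvGen_iff.1 (Quot.eqvGen_exact hDE)
    rw [dihedral_iff] at hr
    obtain ⟨hD, hDN, hD0⟩ := hdis D
    obtain ⟨hE, hEN, hE0⟩ := hdis E
    have hfE := hfp E
    rcases hr with hr | hr
    · rw [← eq_of_append_singleton_isRotated (hf D).isOrdering.1 hr] at hfE
      refine Subtype.ext (eq_of_even_cover_iff (fun p hp => ⟨hD.two_le p hp, hDN p hp⟩)
        (fun p hp => ⟨hE.two_le p hp, hEN p hp⟩) fun x hx y hy hxy => ?_)
      exact even_cover_iff_of_pairwise (hfp D) hfE ((hf D).mem_iff.2 ⟨x.zero_le, hx⟩)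
        ((hf D).mem_iff.2 ⟨y.zero_le, hy⟩) hxy
    · rw [List.reverse_append] at hr
      have h1 := eq_of_append_singleton_isRotated (hf D).isOrdering.1
        (hr.trans List.isRotated_append)
      rw [← List.reverse_reverse (f E), ← h1] at hfE
      exact (not_pairwise_reverse (by omega) hDN hEN hD0 hE0 (hf D) (hfp D) hfE).elim
  · induction q using Quot.ind with
    | _ l =>
      obtain ⟨l, hl, T, hT, hP, hPl⟩ := l
      have hmem : N ∈ l := by
        rw [← List.mem_toFinset, hl.2]
        simp
      obtain ⟨l', hl'⟩ := exists_append_singleton_isRotated hmem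
      have hsep : Separable 0 N l' := separable_of_isTreeSplits (by omega)
        ⟨hl'.nodup_iff.2 hl.1, by rw [← hl.2]; exact List.toFinset_eq_of_perm _ _ hl'.perm⟩ hT hP
        fun A hA => (hPl A hA).of_isRotated hl'
      obtain ⟨D, hD, hDN, hD0, hp⟩ := hsep.exists_isLaminar_proper
      refine ⟨⟨D, fun p hp => ⟨hD.two_le p hp, hDN p hp, fun h => hD0 ?_⟩, hD.not_crosses⟩,
        Quot.sound (dihedral_iff.2 ?_)⟩
      · have hpN : p = (0, N) := Prod.ext h.1 h.2
        rwa [← hpN]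
      · rcases hp with hp | hp
        · left
          change f _ ++ [N] ~r l
          rw [(hf _).eq_of_pairwise hsep (hfp _) hp]
          exact hl'
        · right
          change f _ ++ [N] ~r l.reverse
          rw [(hf _).eq_of_pairwise hsep.reverse (hfp _) hp]
          have h1 := hl'.reverse
          rw [List.reverse_append] at h1
          exact List.isRotated_append.trans h1
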